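/- For every integer j ≥ 1, the 2-dimensional Lebesgue measure of the region S_X(j) = R(j) ∪ ([−(2j+1),0] × [0,2j+1]) ∪ ([−(2j+1),2j] × [−(4j+1),0]) ⊆ ℝ² equals 22j² + 14j + 2. -/

import Mathlib

open MeasureTheory Set ENNReal

/-- The recursively defined sequence of lattice points `(a_i^{(j)}, b_i^{(j)})`
(`ab j i` is `(a_i^{(j)}, b_i^{(j)})` for `1 ≤ i ≤ j+1`):
`[(a_i,b_i)^{(1)}] = [(1,3),(2,1)]`, and for `j ≥ 2`,
`(a_1,b_1)^{(j)} = (1, 2j+1)` and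
`(a_i,b_i)^{(j)} = (b_{j+2−i}^{(j−1)} + 1, a_{j+2−i}^{(j−1)} + 1)` for `2 ≤ i ≤ j+1`. -/
def ab : ℕ → ℕ → ℤ × ℤ
  | 0, _ => (0, 0)
  | 1, i => if i = 1 then (1, 3) else if i = 2 then (2, 1) else (0, 0)
  | (j + 2), i =>
      if i = 1 then (1, 2 * (j + 2) + 1)
      else ((ab (j + 1) ((j + 2) + 2 - i)).2 + 1, (ab (j + 1) ((j + 2) + 2 - i)).1 + 1)

/-- The region `R(j) = ⋃_{i=1}^{j+1} [0, a_i^{(j)}] × [0, b_i^{(j)}] ⊆ ℝ²`. -/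
def Rreg (j : ℕ) : Set (ℝ × ℝ) :=
  ⋃ i ∈ Finset.Icc 1 (j + 1),
    Set.Icc (0 : ℝ) ((ab j i).1 : ℝ) ×ˢ Set.Icc (0 : ℝ) ((ab j i).2 : ℝ)

/-- The region of `P_X(j)` for `j ≥ 1`:
`S_X(j) = R(j) ∪ ([−(2j+1),0] × [0,2j+1]) ∪ ([−(2j+1),2j] × [−(4j+1),0])`. -/
def SX (j : ℕ) : Set (ℝ × ℝ) :=
  Rreg j ∪
    Set.Icc (-(2 * (j : ℝ) + 1)) (0 : ℝ) ×ˢ Set.Icc (0 : ℝ) (2 * (j : ℝ) + 1) ∪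
    Set.Icc (-(2 * (j : ℝ) + 1)) (2 * (j : ℝ)) ×ˢ Set.Icc (-(4 * (j : ℝ) + 1)) (0 : ℝ)

/-- The staircase region `Rreg j` with the left and bottom sides removed. -/
def openStair (j : ℕ) : Set (ℝ × ℝ) :=
  ⋃ i ∈ Finset.Icc 1 (j + 1),
    Set.Ioc (0 : ℝ) ((ab j i).1 : ℝ) ×ˢ Set.Ioc (0 : ℝ) ((ab j i).2 : ℝ)

theorem mem_openStair {j : ℕ} {p : ℝ × ℝ} :
    p ∈ openStair j ↔ ∃ i, (1 ≤ i ∧ i ≤ j + 1) ∧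
      (0 < p.1 ∧ p.1 ≤ (ab j i).1) ∧ 0 < p.2 ∧ p.2 ≤ (ab j i).2 := by
  simp only [openStair, Set.mem_iUnion, Finset.mem_Icc, Set.mem_prod, Set.mem_Ioc, exists_prop]

theorem mem_Rreg {j : ℕ} {p : ℝ × ℝ} :
    p ∈ Rreg j ↔ ∃ i, (1 ≤ i ∧ i ≤ j + 1) ∧
      (0 ≤ p.1 ∧ p.1 ≤ (ab j i).1) ∧ 0 ≤ p.2 ∧ p.2 ≤ (ab j i).2 := by
  simp only [Rreg, Set.mem_iUnion, Finset.mem_Icc, Set.mem_prod, Set.mem_Icc, exists_prop]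

theorem measurableSet_openStair (j : ℕ) : MeasurableSet (openStair j) :=
  Finset.measurableSet_biUnion _ fun _ _ => measurableSet_Ioc.prod measurableSet_Ioc

theorem ab_one {j : ℕ} (hj : 1 ≤ j) : ab j 1 = (1, 2 * (j : ℤ) + 1) := by
  obtain _ | _ | j := j
  · omega
  · simp [ab]
  · simp [ab, add_assoc]

theorem ab_succ {j i : ℕ} (hj : 1 ≤ j) (hi : i ≠ 1) :
    ab (j + 1) i = ((ab j (j + 3 - i)).2 + 1, (ab j (j + 3 - i)).1 + 1) := by
  obtain _ | j := j
  · omega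
  · simp [ab, hi]

theorem ab_le {j : ℕ} (hj : 1 ≤ j) :
    ∀ i, (ab j i).1 ≤ 2 * j + 1 ∧ (ab j i).2 ≤ 2 * j + 1 := by
  induction j, hj using Nat.le_induction with
  | base => intro i; simp only [ab]; split_ifs <;> simp
  | succ j hj ih =>
    intro i
    by_cases hi : i = 1
    · subst hi; rw [ab_one (by omega)]; push_cast; constructor <;> omega
    · rw [ab_succ hj hi]
      have := ih (j + 3 - i)
      push_cast; constructor <;> omega

theorem pos_of_mem_openStair {j : ℕ} {p : ℝ × ℝ} (h : p ∈ openStair j) : 0 < p.1 ∧ 0 < p.2 := by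
  obtain ⟨i, -, h1, h2⟩ := mem_openStair.1 h
  exact ⟨h1.1, h2.1⟩

theorem openStair_one :
    openStair 1 = Ioc (0 : ℝ) 1 ×ˢ Ioc (0 : ℝ) 3 ∪ Ioc (1 : ℝ) 2 ×ˢ Ioc (0 : ℝ) 1 := by
  ext ⟨x, y⟩
  rw [mem_openStair]
  simp only [Set.mem_union, Set.mem_prod, Set.mem_Ioc]
  constructor
  · rintro ⟨i, ⟨hi1, hi2⟩, h1, h2⟩
    interval_cases i
    · simp [ab] at h1 h2; exact Or.inl ⟨h1, h2⟩
    · simp [ab] at h1 h2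
      rcases le_or_gt x 1 with hx | hx
      · exact Or.inl ⟨⟨h1.1, hx⟩, h2.1, by linarith⟩
      · exact Or.inr ⟨⟨hx, h1.2⟩, h2⟩
  · rintro (⟨h1, h2⟩ | ⟨h1, h2⟩)
    · exact ⟨1, by simp, by simpa [ab] using h1, by simpa [ab] using h2⟩
    · exact ⟨2, by simp, by simpa [ab] using ⟨by linarith, h1.2⟩, by simpa [ab] using h2⟩

/-- The staircase of index `j + 1` splits into its first column, the rest of its bottom row and a
reflected translate of the staircase of index `j`. -/
theorem openStair_succ {j : ℕ} (hj : 1 ≤ j) :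
    openStair (j + 1) =
      Ioc (0 : ℝ) 1 ×ˢ Ioc (0 : ℝ) (2 * j + 3) ∪ Ioc (1 : ℝ) (2 * j + 2) ×ˢ Ioc (0 : ℝ) 1 ∪
        (fun p : ℝ × ℝ => (p - (1, 1)).swap) ⁻¹' openStair j := by
  ext ⟨x, y⟩
  simp only [Set.mem_union, Set.mem_prod, Set.mem_Ioc, Set.mem_preimage, mem_openStair,
    Prod.mk_sub_mk, Prod.swap_prod_mk]
  constructor
  · rintro ⟨i, hi, h1, h2⟩
    by_cases hi1 : i = 1
    · subst hi1
      rw [ab_one (by omega)] at h1 h2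
      push_cast at h1 h2
      exact Or.inl (Or.inl ⟨h1, h2.1, by linarith⟩)
    · rw [ab_succ hj hi1] at h1 h2
      obtain ⟨ha, hb⟩ := ab_le hj (j + 3 - i)
      have ha' : ((ab j (j + 3 - i)).1 : ℝ) ≤ 2 * j + 1 := by exact_mod_cast ha
      have hb' : ((ab j (j + 3 - i)).2 : ℝ) ≤ 2 * j + 1 := by exact_mod_cast hb
      push_cast at h1 h2
      rcases le_or_gt x 1 with hx | hx
      · exact Or.inl (Or.inl ⟨⟨h1.1, hx⟩, h2.1, by linarith⟩)
      rcases le_or_gt y 1 with hy | hy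
      · exact Or.inl (Or.inr ⟨⟨hx, by linarith⟩, h2.1, hy⟩)
      · exact Or.inr ⟨j + 3 - i, by omega, ⟨by linarith, by linarith⟩, by linarith, by linarith⟩
  · rintro ((⟨h1, h2⟩ | ⟨h1, h2⟩) | ⟨i, hi, h1, h2⟩)
    · refine ⟨1, by omega, ?_⟩
      rw [ab_one (by omega)]
      push_cast
      exact ⟨h1, h2.1, by linarith⟩
    · refine ⟨j + 2, by omega, ?_⟩
      rw [ab_succ hj (by omega), show j + 3 - (j + 2) = 1 by omega, ab_one hj]
      push_cast
      exact ⟨⟨by linarith, by linarith⟩, h2.1, by linarith⟩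
    · refine ⟨j + 3 - i, by omega, ?_⟩
      rw [ab_succ hj (by omega), show j + 3 - (j + 3 - i) = i by omega]
      push_cast
      exact ⟨⟨by linarith, by linarith⟩, by linarith, by linarith⟩

theorem volume_Ioc_prod_Ioc (a b c d : ℝ) :
    volume (Ioc a b ×ˢ Ioc c d) = ENNReal.ofReal (b - a) * ENNReal.ofReal (d - c) := by
  rw [Measure.volume_eq_prod, Measure.prod_prod, Real.volume_Ioc, Real.volume_Ioc]

theorem volume_preimage_swap_sub (c : ℝ × ℝ) {s : Set (ℝ × ℝ)} (hs : MeasurableSet s) :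
    volume ((fun p : ℝ × ℝ => (p - c).swap) ⁻¹' s) = volume s :=
  ((Measure.measurePreserving_swap (μ := (volume : Measure ℝ)) (ν := volume)).comp
    (measurePreserving_sub_right (volume : Measure (ℝ × ℝ)) c)).measure_preimage
      hs.nullMeasurableSet

theorem volume_openStair {j : ℕ} (hj : 1 ≤ j) :
    volume (openStair j) = ENNReal.ofReal (2 * j ^ 2 + 2 * j) := by
  induction j, hj using Nat.le_induction with
  | base =>
    rw [openStair_one, measure_union _ (measurableSet_Ioc.prod measurableSet_Ioc),
      volume_Ioc_prod_Ioc, volume_Ioc_prod_Ioc, ← ENNReal.ofReal_mul (by norm_num),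
      ← ENNReal.ofReal_mul (by norm_num), ← ENNReal.ofReal_add (by norm_num) (by norm_num)]
    · norm_num
    · rw [Set.disjoint_left]
      rintro ⟨x, y⟩ ⟨⟨-, h1⟩, -⟩ ⟨⟨h2, -⟩, -⟩
      exact absurd h1 (not_le.2 h2)
  | succ j hj ih =>
    have hmeas : MeasurableSet ((fun p : ℝ × ℝ => (p - (1, 1)).swap) ⁻¹' openStair j) :=
      (measurable_swap.comp (measurable_id.sub_const _)) (measurableSet_openStair j)
    rw [openStair_succ hj, measure_union _ hmeas,
      measure_union _ (measurableSet_Ioc.prod measurableSet_Ioc),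
      volume_preimage_swap_sub _ (measurableSet_openStair j), ih,
      volume_Ioc_prod_Ioc, volume_Ioc_prod_Ioc, ← ENNReal.ofReal_mul (by norm_num),
      ← ENNReal.ofReal_mul (by linarith [Nat.cast_nonneg (α := ℝ) j]),
      ← ENNReal.ofReal_add (by ring_nf; positivity) (by ring_nf; positivity),
      ← ENNReal.ofReal_add (by ring_nf; positivity) (by positivity)]
    · congr 1
      push_cast
      ring
    · rw [Set.disjoint_left]
      rintro ⟨x, y⟩ ⟨⟨-, h1⟩, -⟩ ⟨⟨h2, -⟩, -⟩
      exact absurd h1 (not_le.2 h2)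
    · rw [Set.disjoint_left]
      rintro ⟨x, y⟩ h h'
      have hpos := pos_of_mem_openStair h'
      simp only [Prod.mk_sub_mk, Prod.swap_prod_mk] at hpos
      rcases h with ⟨⟨-, h1⟩, -⟩ | ⟨-, -, h1⟩ <;> dsimp only at h1 <;> linarith

theorem volume_vertical_line (c : ℝ) : volume {p : ℝ × ℝ | p.1 = c} = 0 := by
  have : {p : ℝ × ℝ | p.1 = c} = {c} ×ˢ univ := by ext; simp
  rw [this, Measure.volume_eq_prod, Measure.prod_prod]
  simp

theorem volume_horizontal_line (c : ℝ) : volume {p : ℝ × ℝ | p.2 = c} = 0 := by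
  have : {p : ℝ × ℝ | p.2 = c} = univ ×ˢ {c} := by ext; simp
  rw [this, Measure.volume_eq_prod, Measure.prod_prod]
  simp

theorem Rreg_ae_eq_openStair (j : ℕ) : Rreg j =ᵐ[volume] openStair j := by
  have h1 : ∀ᵐ p : ℝ × ℝ, p.1 ≠ 0 := by simpa [ae_iff] using volume_vertical_line 0
  have h2 : ∀ᵐ p : ℝ × ℝ, p.2 ≠ 0 := by simpa [ae_iff] using volume_horizontal_line 0
  filter_upwards [h1, h2] with p hp1 hp2
  refine propext (mem_Rreg.trans (Iff.trans ?_ mem_openStair.symm))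
  simp only [lt_iff_le_and_ne, hp1.symm, hp2.symm, ne_eq, not_false_eq_true, and_true]

theorem Icc_prod_Icc_ae_eq (a b c d : ℝ) :
    Icc a b ×ˢ Icc c d =ᵐ[(volume : Measure (ℝ × ℝ))] Ioc a b ×ˢ Ioc c d :=
  Measure.set_prod_ae_eq Ioc_ae_eq_Icc.symm Ioc_ae_eq_Icc.symm

/-- For every integer `j ≥ 1`, the area of `S_X(j)` equals `22j² + 14j + 2`. -/
theorem stmt_12 (j : ℕ) (hj : 1 ≤ j) :
    volume (SX j) = ((22 * j ^ 2 + 14 * j + 2 : ℕ) : ℝ≥0∞) := by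
  have hj0 : (0 : ℝ) ≤ j := Nat.cast_nonneg j
  have hae := ((Rreg_ae_eq_openStair j).union
    (Icc_prod_Icc_ae_eq (-(2 * (j : ℝ) + 1)) 0 0 (2 * j + 1))).union
    (Icc_prod_Icc_ae_eq (-(2 * (j : ℝ) + 1)) (2 * j) (-(4 * (j : ℝ) + 1)) 0)
  rw [SX, measure_congr hae, measure_union _ (measurableSet_Ioc.prod measurableSet_Ioc),
    measure_union _ (measurableSet_Ioc.prod measurableSet_Ioc), volume_openStair hj,
    volume_Ioc_prod_Ioc, volume_Ioc_prod_Ioc, ← ENNReal.ofReal_mul (by linarith),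
    ← ENNReal.ofReal_mul (by linarith), ← ENNReal.ofReal_add (by positivity) (by ring_nf; positivity),
    ← ENNReal.ofReal_add (by ring_nf; positivity) (by ring_nf; positivity),
    ← ENNReal.ofReal_natCast]
  · congr 1
    push_cast
    ring
  · rw [Set.disjoint_left]
    rintro p h ⟨⟨-, h1⟩, -⟩
    exact absurd (pos_of_mem_openStair h).1 (not_lt.2 h1)
  · rw [Set.disjoint_left]
    rintro p h ⟨-, -, h1⟩
    rcases h with h | ⟨-, h2, -⟩
    · exact absurd (pos_of_mem_openStair h).2 (not_lt.2 h1)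
    · exact absurd h2 (not_lt.2 h1)
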